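/- Let a ⊂ ℝ^n be a closed cone of the form a₊ = {z : α_i(z) ≥ 0 for all i} where α_1, …, α_n are linearly independent linear functionals, let ω_1, …, ω_n be the dual basis (α_i(ω_j) = δ_ij), and let ρ = ∑_{i=1}^n k_i α_i with all k_i > 0. Set k = min_i (k_i / ‖ω_i‖). Then there exist constants C₁, C₂ > 0 such that for all z > 0: C₁ e^{−kz} ≤ ∫_{{v ∈ a₊ : ‖v‖ ≥ z}} e^{−ρ(v)} dv ≤ C₂ e^{−kz}, where ‖·‖ is the Euclidean norm and dv the Lebesgue measure on ℝ^n. -/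

import Mathlib

open MeasureTheory

theorem exists_pos_forall_mul_le {ι : Type*} [Finite ι] (b c : ι → ℝ) (hc : ∀ j, 0 < c j) :
    ∃ ε > (0 : ℝ), ∀ j, ε * b j ≤ c j := by
  have h : ∀ᶠ ε in nhdsWithin (0 : ℝ) (Set.Ioi 0), ∀ j, ε * b j ≤ c j := by
    refine Filter.eventually_all.2 fun j => ?_
    have ht : Filter.Tendsto (fun ε : ℝ => ε * b j) (nhdsWithin 0 (Set.Ioi 0)) (nhds 0) := by
      have : Filter.Tendsto (fun ε : ℝ => ε * b j) (nhds 0) (nhds (0 * b j)) :=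
        (continuous_id.mul continuous_const).tendsto 0
      rw [zero_mul] at this
      exact this.mono_left nhdsWithin_le_nhds
    exact (ht.eventually (gt_mem_nhds (hc j))).mono fun _ h => le_of_lt h
  obtain ⟨ε, h1, h2⟩ := (h.and self_mem_nhdsWithin).exists
  exact ⟨ε, h2, h1⟩

section Haar

variable {E : Type*} [NormedAddCommGroup E] [NormedSpace ℝ E] [MeasurableSpace E] [BorelSpace E]
  (μ : Measure E) [μ.IsAddHaarMeasure]

theorem integrable_exp_neg_mul_norm [FiniteDimensional ℝ E] {ε : ℝ} (hε : 0 < ε) :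
    Integrable (fun v : E => Real.exp (-(ε * ‖v‖))) μ := by
  set m := Module.finrank ℝ E + 1
  have h1 : Integrable (fun v : E => (1 + ‖v‖) ^ (-(m : ℝ))) μ :=
    integrable_one_add_norm (by simp [m])
  refine (h1.const_mul (Real.exp ε * m.factorial / ε ^ m)).mono' (by fun_prop) ?_
  filter_upwards with v
  have hv : 0 < 1 + ‖v‖ := by positivity
  rw [Real.norm_eq_abs, Real.abs_exp, Real.rpow_neg hv.le, Real.rpow_natCast]
  have h2 := Real.pow_div_factorial_le_exp (ε * (1 + ‖v‖)) (by positivity) m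
  have h3 : Real.exp (-(ε * ‖v‖)) = Real.exp ε * (Real.exp (ε * (1 + ‖v‖)))⁻¹ := by
    rw [← Real.exp_neg, ← Real.exp_add]; ring_nf
  rw [h3]
  calc Real.exp ε * (Real.exp (ε * (1 + ‖v‖)))⁻¹
      ≤ Real.exp ε * ((ε * (1 + ‖v‖)) ^ m / m.factorial)⁻¹ := by gcongr
    _ = _ := by rw [mul_pow]; field_simp

theorem setIntegral_exp_neg_translate (ρ : E →ₗ[ℝ] ℝ) (P : Set E) (u : E) :
    ∫ v in {v | v - u ∈ P}, Real.exp (-ρ v) ∂μ =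
      Real.exp (-ρ u) * ∫ v in P, Real.exp (-ρ v) ∂μ := by
  have h := (measurePreserving_sub_right μ u).setIntegral_preimage_emb
    (measurableEmbedding_subRight u) (fun v => Real.exp (-ρ u) * Real.exp (-ρ v)) P
  rw [← integral_const_mul, ← h]
  refine integral_congr_ae (.of_forall fun v => ?_)
  simp only [map_sub, ← Real.exp_add]
  ring_nf

end Haar

section DualPair

variable {ι E : Type*} [NormedAddCommGroup E] [NormedSpace ℝ E] {α : ι → E →ₗ[ℝ] ℝ} {ω : ι → E}

theorem sum_apply_smul_of_dual [Fintype ι] [DecidableEq ι] [FiniteDimensional ℝ E]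
    (hcard : Fintype.card ι = Module.finrank ℝ E)
    (hdual : ∀ i j, α i (ω j) = if i = j then (1 : ℝ) else 0) (v : E) :
    ∑ j, α j v • ω j = v := by
  have hli : LinearIndependent ℝ ω := by
    rw [Fintype.linearIndependent_iff]
    intro g hg i
    simpa [hdual] using congrArg (α i) hg
  have hv : v ∈ Submodule.span ℝ (Set.range ω) := by
    rw [hli.span_eq_top_of_card_eq_finrank' hcard]; trivial
  obtain ⟨c, rfl⟩ := (Submodule.mem_span_range_iff_exists_fun ℝ).1 hv
  simp [hdual]

theorem mul_norm_le_of_sum_eq [Fintype ι] (hsum : ∀ v, ∑ j, α j v • ω j = v) {c : ι → ℝ} {k : ℝ}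
    (hk : 0 ≤ k) (hkc : ∀ j, k * ‖ω j‖ ≤ c j) {v : E} (hv : ∀ j, 0 ≤ α j v) :
    k * ‖v‖ ≤ ∑ j, c j * α j v := by
  calc k * ‖v‖ = k * ‖∑ j, α j v • ω j‖ := by rw [hsum]
    _ ≤ k * ∑ j, ‖α j v • ω j‖ := by gcongr; exact norm_sum_le _ _
    _ = ∑ j, (k * ‖ω j‖) * α j v := by
        rw [Finset.mul_sum]
        refine Finset.sum_congr rfl fun j _ => ?_
        rw [norm_smul, Real.norm_of_nonneg (hv j)]; ring
    _ ≤ _ := Finset.sum_le_sum fun j _ => mul_le_mul_of_nonneg_right (hkc j) (hv j)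

theorem integrableOn_exp_neg_cone [Fintype ι] [FiniteDimensional ℝ E]
    [MeasurableSpace E] [BorelSpace E] (μ : Measure E)
    [μ.IsAddHaarMeasure] (hsum : ∀ v, ∑ j, α j v • ω j = v) {c : ι → ℝ} (hc : ∀ j, 0 < c j) :
    IntegrableOn (fun v => Real.exp (-∑ j, c j * α j v)) {v | ∀ j, 0 ≤ α j v} μ := by
  have hcont : ∀ j, Continuous (α j) := fun j => (α j).continuous_of_finiteDimensional
  obtain ⟨ε, hε, hb⟩ := exists_pos_forall_mul_le (fun j => ‖ω j‖) c hc
  refine (integrable_exp_neg_mul_norm μ hε).integrableOn.mono'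
    (by fun_prop) ?_
  refine ae_restrict_of_forall_mem ?_ fun v hv => ?_
  · simp only [Set.ofPred_forall]
    exact MeasurableSet.iInter fun j => measurableSet_le measurable_const (hcont j).measurable
  · rw [Real.norm_eq_abs, Real.abs_exp]
    gcongr
    exact mul_norm_le_of_sum_eq hsum hε.le hb hv

theorem not_sameRay_of_dual [DecidableEq ι]
    (hdual : ∀ i j, α i (ω j) = if i = j then (1 : ℝ) else 0) {i j : ι} (hij : i ≠ j) :
    ¬ SameRay ℝ (ω i) (ω j) := by
  have hne : ∀ l, ω l ≠ 0 := fun l h => by simpa [h] using hdual l l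
  rintro (h | h | ⟨r, s, hr, hs, h⟩)
  · exact hne _ h
  · exact hne _ h
  · have := congrArg (α i) h
    simp [hdual, hij] at this
    exact hr.ne' this

/-- On the part of the cone where the `i`-th coordinate dominates, strict convexity of the norm
improves the bound `k * ‖v‖ ≤ ∑ j, c j * α j v` by a linear term in the other coordinates. -/
theorem exists_mul_norm_add_sum_le [Fintype ι] [DecidableEq ι] [StrictConvexSpace ℝ E]
    (hdual : ∀ i j, α i (ω j) = if i = j then (1 : ℝ) else 0)
    (hsum : ∀ v, ∑ j, α j v • ω j = v) {c : ι → ℝ} {k : ℝ}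
    (hk : 0 < k) (hkc : ∀ j, k * ‖ω j‖ ≤ c j) (i : ι) :
    ∃ d : ι → ℝ, (∀ j, 0 < d j) ∧ ∀ v, (∀ j, 0 ≤ α j v) → (∀ j, α j v ≤ α i v) →
      k * ‖v‖ + ∑ j ∈ Finset.univ.erase i, d j * α j v ≤ ∑ j, c j * α j v := by
  have : Nonempty ι := ⟨i⟩
  set N : ℝ := (Fintype.card ι : ℝ)
  have hN : 1 ≤ N := Nat.one_le_cast.2 Fintype.card_pos
  have hN0 : 0 < N := by linarith
  have hgap : ∀ j, j ≠ i → 0 < c i + c j - k * ‖ω i + ω j‖ := fun j hj => by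
    have := mul_lt_mul_of_pos_left
      (norm_add_lt_of_not_sameRay (not_sameRay_of_dual hdual hj.symm)) hk
    linarith [hkc i, hkc j]
  refine ⟨fun j => if j = i then 1 else (c i + c j - k * ‖ω i + ω j‖) / N, fun j => ?_,
    fun v hv hmax => ?_⟩
  · dsimp only
    split_ifs with h
    · exact one_pos
    · exact div_pos (hgap j h) hN0
  set I := Finset.univ.erase i
  have hsplit : ∀ f : ι → ℝ, ∑ j, f j = f i + ∑ j ∈ I, f j := fun f =>
    (Finset.add_sum_erase _ f (Finset.mem_univ i)).symm
  have hS : ∑ j ∈ I, α j v / N ≤ α i v := by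
    calc ∑ j ∈ I, α j v / N ≤ ∑ j, α j v / N :=
          Finset.sum_le_sum_of_subset_of_nonneg (Finset.subset_univ _)
            fun j _ _ => div_nonneg (hv j) hN0.le
      _ ≤ ∑ _j : ι, α i v / N := by gcongr with j; exact hmax j
      _ = α i v := by simp [N]; field_simp
  have hdecomp : v = (∑ j ∈ I, (α j v / N) • (ω i + ω j)) +
      ((α i v - ∑ j ∈ I, α j v / N) • ω i + ∑ j ∈ I, (α j v - α j v / N) • ω j) := by
    conv_lhs => rw [← hsum v, ← Finset.add_sum_erase _ _ (Finset.mem_univ i)]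
    simp only [smul_add, sub_smul, Finset.sum_add_distrib, Finset.sum_sub_distrib,
      Finset.sum_smul]
    abel
  have hnorm : ‖v‖ ≤ (∑ j ∈ I, (α j v / N) * ‖ω i + ω j‖) +
      ((α i v - ∑ j ∈ I, α j v / N) * ‖ω i‖ + ∑ j ∈ I, (α j v - α j v / N) * ‖ω j‖) := by
    have hsm : ∀ (t : ℝ) (w : E), 0 ≤ t → ‖t • w‖ = t * ‖w‖ := fun t w ht => by
      rw [norm_smul, Real.norm_of_nonneg ht]
    conv_lhs => rw [hdecomp]
    refine norm_add_le_of_le (norm_sum_le_of_le _ fun j _ => ?_)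
      (norm_add_le_of_le ?_ (norm_sum_le_of_le _ fun j _ => ?_))
    · exact (hsm _ _ (div_nonneg (hv j) hN0.le)).le
    · exact (hsm _ _ (sub_nonneg.2 hS)).le
    · exact (hsm _ _ (sub_nonneg.2 (div_le_self (hv j) hN))).le
  have h1 : (α i v - ∑ j ∈ I, α j v / N) * (k * ‖ω i‖) ≤
      (α i v - ∑ j ∈ I, α j v / N) * c i :=
    mul_le_mul_of_nonneg_left (hkc i) (sub_nonneg.2 hS)
  have h2 : ∑ j ∈ I, (α j v - α j v / N) * (k * ‖ω j‖) ≤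
      ∑ j ∈ I, (α j v - α j v / N) * c j :=
    Finset.sum_le_sum fun j _ => mul_le_mul_of_nonneg_left (hkc j)
      (sub_nonneg.2 (div_le_self (hv j) hN))
  have h3 : ∑ j ∈ I, (if j = i then 1 else (c i + c j - k * ‖ω i + ω j‖) / N) * α j v =
      ∑ j ∈ I, (c i + c j - k * ‖ω i + ω j‖) / N * α j v :=
    Finset.sum_congr rfl fun j hj => by rw [if_neg (Finset.ne_of_mem_erase hj)]
  have h4 := mul_le_mul_of_nonneg_left hnorm hk.le
  have h5 : ∑ j ∈ I, (c i + c j - k * ‖ω i + ω j‖) / N * α j v =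
      (∑ j ∈ I, α j v / N) * c i + ∑ j ∈ I, α j v / N * c j -
        k * ∑ j ∈ I, (α j v / N) * ‖ω i + ω j‖ := by
    rw [Finset.sum_mul, Finset.mul_sum, ← Finset.sum_add_distrib, ← Finset.sum_sub_distrib]
    exact Finset.sum_congr rfl fun j _ => by ring
  have h6 : ∑ j ∈ I, (α j v - α j v / N) * (k * ‖ω j‖) =
      k * ∑ j ∈ I, (α j v - α j v / N) * ‖ω j‖ := by
    rw [Finset.mul_sum]
    exact Finset.sum_congr rfl fun j _ => by ring
  have h7 : ∑ j ∈ I, (α j v - α j v / N) * c j =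
      ∑ j ∈ I, c j * α j v - ∑ j ∈ I, α j v / N * c j := by
    rw [← Finset.sum_sub_distrib]
    exact Finset.sum_congr rfl fun j _ => by ring
  rw [h3, h5, hsplit]
  linarith

variable [Fintype ι] [DecidableEq ι] [FiniteDimensional ℝ E] [MeasurableSpace E] [BorelSpace E]
  (μ : Measure E) [μ.IsAddHaarMeasure]

/-- The part of the cone outside the ball where the `i`-th coordinate dominates lies in a translate
along `ω i` of a fixed sheared cone, whose weighted measure decays like `exp (-k * z)`. -/
theorem exists_setIntegral_sector_le [StrictConvexSpace ℝ E]
    (hcard : Fintype.card ι = Module.finrank ℝ E)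
    (hdual : ∀ i j, α i (ω j) = if i = j then (1 : ℝ) else 0) {c : ι → ℝ} {k : ℝ}
    (hc : ∀ j, 0 < c j) (hk : 0 < k) (hkc : ∀ j, k * ‖ω j‖ ≤ c j) (i : ι) :
    ∃ C : ℝ, 0 ≤ C ∧ ∀ z > (0 : ℝ), ∃ D : Set E,
      {v | (∀ j, 0 ≤ α j v) ∧ (∀ j, α j v ≤ α i v) ∧ z ≤ ‖v‖} ⊆ D ∧
      IntegrableOn (fun v => Real.exp (-∑ j, c j * α j v)) D μ ∧
      ∫ v in D, Real.exp (-∑ j, c j * α j v) ∂μ ≤ C * Real.exp (-k * z) := by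
  have hsum := sum_apply_smul_of_dual hcard hdual
  obtain ⟨d, hd, hgap⟩ := exists_mul_norm_add_sum_le hdual hsum hk hkc i
  let m : ι → ℝ := fun j => if j = i then 0 else (c j - d j) / c i
  let g : ι → E →ₗ[ℝ] ℝ := fun j => α j + if j = i then ∑ l, m l • α l else 0
  let u : ι → E := fun j => ω j - m j • ω i
  let e : ι → ℝ := fun j => if j = i then c i else d j
  let ρ : E →ₗ[ℝ] ℝ := ∑ j, c j • α j
  have hρ : ∀ v, ∑ j, c j * α j v = ρ v := fun v => by simp [ρ]
  have hmi : m i = 0 := by simp [m]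
  have hg : ∀ j, j ≠ i → g j = α j := fun j hj => by simp [g, hj]
  have hgi : ∀ v, g i v = α i v + ∑ l, m l * α l v := fun v => by simp [g]
  have hgu : ∀ j l, g j (u l) = if j = l then (1 : ℝ) else 0 := by
    intro j l
    by_cases hj : j = i
    · subst hj
      simp [hgi, u, hdual, mul_sub, hmi]
    · simp [hg j hj, u, hdual, hj]
  have hsum' := sum_apply_smul_of_dual hcard hgu
  have he : ∀ j, 0 < e j := fun j => by
    dsimp only [e]; split_ifs
    exacts [hc i, hd j]
  have hI : ∀ f : ι → ℝ, ∑ j, f j = f i + ∑ j ∈ Finset.univ.erase i, f j := fun f =>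
    (Finset.add_sum_erase _ f (Finset.mem_univ i)).symm
  have hβ : ∀ v, c i * g i v = c i * α i v + ∑ j ∈ Finset.univ.erase i, (c j - d j) * α j v := by
    intro v
    rw [hgi, hI, hmi, zero_mul, zero_add, mul_add, Finset.mul_sum]
    congr 1
    refine Finset.sum_congr rfl fun j hj => ?_
    have := (hc i).ne'
    simp only [m, if_neg (Finset.ne_of_mem_erase hj)]
    field_simp
  have heg : ∀ v, ∑ j, e j * g j v = ρ v := by
    intro v
    rw [← hρ, hI, hI fun j => c j * α j v]
    simp only [e, if_true]
    rw [hβ, add_assoc, ← Finset.sum_add_distrib]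
    congr 1
    refine Finset.sum_congr rfl fun j hj => ?_
    rw [if_neg (Finset.ne_of_mem_erase hj), hg j (Finset.ne_of_mem_erase hj)]
    ring
  have hint : IntegrableOn (fun v => Real.exp (-ρ v)) {v | ∀ j, 0 ≤ g j v} μ := by
    have := integrableOn_exp_neg_cone μ hsum' he
    simpa only [heg] using this
  simp only [hρ]
  refine ⟨∫ v in {v | ∀ j, 0 ≤ g j v}, Real.exp (-ρ v) ∂μ,
    integral_nonneg fun _ => (Real.exp_pos _).le, fun z hz => ?_⟩
  have hgω : ∀ j, g j (ω i) = if j = i then 1 else 0 := fun j => by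
    have := hgu j i
    simpa [u, hmi] using this
  refine ⟨{v | v - (k * z / c i) • ω i ∈ {v | ∀ j, 0 ≤ g j v}}, ?_, ?_, ?_⟩
  · rintro v ⟨hv, hmax, hvz⟩ j
    rw [map_sub, map_smul, hgω]
    by_cases hj : j = i
    · subst hj
      have h1 := hgap v hv hmax
      rw [hI] at h1
      have h2 := hβ v
      simp only [sub_mul, Finset.sum_sub_distrib] at h2
      have h3 : k * z ≤ c j * g j v := by
        have := mul_le_mul_of_nonneg_left hvz hk.le
        linarith
      simp only [if_true, smul_eq_mul, mul_one, sub_nonneg]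
      rw [div_le_iff₀ (hc j)]
      linarith
    · simpa [hj, hg j hj] using hv j
  · refine hint.mono_set fun v hv j => ?_
    have := hv j
    rw [map_sub, map_smul, hgω] at this
    have h1 : 0 ≤ k * z / c i := by have := hc i; positivity
    split_ifs at this <;> simp at this <;> linarith
  · rw [setIntegral_exp_neg_translate]
    have : ρ ((k * z / c i) • ω i) = k * z := by
      have := (hc i).ne'
      rw [map_smul, ← hρ]
      simp [hdual]
      field_simp
    rw [this, mul_comm, neg_mul]

theorem exists_setIntegral_cone_le [StrictConvexSpace ℝ E] [Nonempty ι]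
    (hcard : Fintype.card ι = Module.finrank ℝ E)
    (hdual : ∀ i j, α i (ω j) = if i = j then (1 : ℝ) else 0) {c : ι → ℝ} {k : ℝ}
    (hc : ∀ j, 0 < c j) (hk : 0 < k) (hkc : ∀ j, k * ‖ω j‖ ≤ c j) :
    ∃ C > (0 : ℝ), ∀ z > (0 : ℝ),
      ∫ v in {v | (∀ j, 0 ≤ α j v) ∧ z ≤ ‖v‖}, Real.exp (-∑ j, c j * α j v) ∂μ ≤
        C * Real.exp (-k * z) := by
  choose C hC hD using exists_setIntegral_sector_le μ hcard hdual hc hk hkc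
  refine ⟨1 + ∑ i, C i, add_pos_of_pos_of_nonneg one_pos (Finset.sum_nonneg fun i _ => hC i),
    fun z hz => ?_⟩
  choose D hsub hint hle using fun i => hD i z hz
  have hcov : {v | (∀ j, 0 ≤ α j v) ∧ z ≤ ‖v‖} ⊆ ⋃ i, D i := by
    rintro v ⟨hv, hvz⟩
    obtain ⟨i, hi⟩ := Finite.exists_max fun j => α j v
    exact Set.mem_iUnion.2 ⟨i, hsub i ⟨hv, hi, hvz⟩⟩
  have hμ : μ.restrict {v | (∀ j, 0 ≤ α j v) ∧ z ≤ ‖v‖} ≤ ∑ i, μ.restrict (D i) := by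
    rw [← Measure.sum_fintype]
    exact (Measure.restrict_mono_set μ hcov).trans Measure.restrict_iUnion_le
  calc _ ≤ ∫ v, Real.exp (-∑ j, c j * α j v) ∂(∑ i, μ.restrict (D i)) :=
        integral_mono_measure hμ (.of_forall fun _ => (Real.exp_pos _).le)
          (integrable_finsetSum_measure.2 fun i _ => hint i)
    _ = ∑ i, ∫ v in D i, Real.exp (-∑ j, c j * α j v) ∂μ :=
        integral_finsetSum_measure fun i _ => hint i
    _ ≤ ∑ i, C i * Real.exp (-k * z) := Finset.sum_le_sum fun i _ => hle i
    _ ≤ (1 + ∑ i, C i) * Real.exp (-k * z) := by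
        rw [← Finset.sum_mul]
        gcongr
        linarith

theorem exists_le_setIntegral_cone (hcard : Fintype.card ι = Module.finrank ℝ E)
    (hdual : ∀ i j, α i (ω j) = if i = j then (1 : ℝ) else 0) {c : ι → ℝ}
    (hc : ∀ j, 0 < c j) (i : ι) :
    ∃ C > (0 : ℝ), ∀ z > (0 : ℝ),
      C * Real.exp (-(c i / ‖ω i‖) * z) ≤
      ∫ v in {v | (∀ j, 0 ≤ α j v) ∧ z ≤ ‖v‖}, Real.exp (-∑ j, c j * α j v) ∂μ := by
  have hsum := sum_apply_smul_of_dual hcard hdual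
  have hcont : ∀ j, Continuous (α j) := fun j => (α j).continuous_of_finiteDimensional
  have hω : 0 < ‖ω i‖ := norm_pos_iff.2 fun h => by simpa [h] using hdual i i
  let ρ : E →ₗ[ℝ] ℝ := ∑ j, c j • α j
  have hρ : ∀ v, ∑ j, c j * α j v = ρ v := fun v => by simp [ρ]
  have hint := integrableOn_exp_neg_cone μ hsum hc
  simp only [hρ] at hint ⊢
  let P : Set E := {v | ∀ j, 0 ≤ α j v ∧ α j v ≤ 1}
  have hPpos : 0 < ∫ v in P, Real.exp (-ρ v) ∂μ := by
    rw [setIntegral_pos_iff_support_of_nonneg_ae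
      (.of_forall fun _ => (Real.exp_pos _).le) (hint.mono_set fun v hv j => (hv j).1)]
    have hsupp : Function.support (fun v => Real.exp (-ρ v)) = Set.univ :=
      Set.eq_univ_of_forall fun v => (Real.exp_pos _).ne'
    rw [hsupp, Set.univ_inter]
    let U : Set E := ⋂ j, α j ⁻¹' Set.Ioo 0 1
    have hU : IsOpen U := isOpen_iInter_of_finite fun j => isOpen_Ioo.preimage (hcont j)
    have hne : U.Nonempty := by
      refine ⟨∑ j, (1 / 2 : ℝ) • ω j, Set.mem_iInter.2 fun j => ?_⟩
      simp only [Set.mem_preimage, map_sum, map_smul, hdual]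
      norm_num
    refine (hU.measure_pos μ hne).trans_le (measure_mono fun v hv j => ?_)
    have := Set.mem_iInter.1 hv j
    exact ⟨this.1.le, this.2.le⟩
  set B := ∑ j, ‖ω j‖
  refine ⟨Real.exp (-(c i * (B / ‖ω i‖))) * ∫ v in P, Real.exp (-ρ v) ∂μ, by positivity,
    fun z hz => ?_⟩
  have hB : 0 ≤ B := Finset.sum_nonneg fun _ _ => norm_nonneg _
  set t := (z + B) / ‖ω i‖
  have ht : 0 ≤ t := by positivity
  have hρt : ρ (t • ω i) = c i * t := by
    rw [map_smul, ← hρ]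
    simp [hdual, mul_comm]
  calc _ = ∫ v in {v | v - t • ω i ∈ P}, Real.exp (-ρ v) ∂μ := by
        rw [setIntegral_exp_neg_translate, hρt, mul_right_comm, ← Real.exp_add]
        congr 2
        simp only [t]
        ring
    _ ≤ _ := by
        refine setIntegral_mono_set (hint.mono_set fun v hv => hv.1)
          (.of_forall fun _ => (Real.exp_pos _).le) (LE.le.eventuallyLE fun v hv => ?_)
        have hα : ∀ j, 0 ≤ α j (v - t • ω i) ∧ α j (v - t • ω i) ≤ 1 := hv
        refine ⟨fun j => ?_, ?_⟩
        · have h := (hα j).1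
          rw [map_sub, map_smul, hdual] at h
          split_ifs at h <;> simp at h <;> linarith
        · have h1 : ‖v - t • ω i‖ ≤ B := by
            rw [← hsum (v - t • ω i)]
            refine norm_sum_le_of_le _ fun j _ => ?_
            rw [norm_smul, Real.norm_of_nonneg (hα j).1]
            exact mul_le_of_le_one_left (norm_nonneg _) (hα j).2
          have h2 : ‖t • ω i‖ = z + B := by
            rw [norm_smul, Real.norm_of_nonneg ht]
            exact div_mul_cancel₀ _ hω.ne'
          have h3 := norm_sub_norm_le (t • ω i) v
          rw [norm_sub_rev] at h3
          linarith

end DualPair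

/-- Lemma 5.6: exponential decay rate of the measure e^{-ρ(v)}dv of the complement of
balls in a simplicial cone. -/
theorem stmt_6 (n : ℕ) (hn : 0 < n)
    (α : Fin n → (EuclideanSpace ℝ (Fin n)) →ₗ[ℝ] ℝ)
    (hα : LinearIndependent ℝ α)
    (ω : Fin n → EuclideanSpace ℝ (Fin n))
    (hdual : ∀ i j, α i (ω j) = if i = j then (1 : ℝ) else 0)
    (kc : Fin n → ℝ) (hkc : ∀ i, 0 < kc i)
    (k : ℝ) (hk : IsLeast (Set.range fun i => kc i / ‖ω i‖) k) :
    ∃ C₁ > (0 : ℝ), ∃ C₂ > (0 : ℝ), ∀ z > (0 : ℝ),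
      C₁ * Real.exp (-k * z) ≤
        (∫ v in {v : EuclideanSpace ℝ (Fin n) | (∀ i, 0 ≤ α i v) ∧ z ≤ ‖v‖},
          Real.exp (-(∑ i, kc i * α i v))) ∧
      (∫ v in {v : EuclideanSpace ℝ (Fin n) | (∀ i, 0 ≤ α i v) ∧ z ≤ ‖v‖},
          Real.exp (-(∑ i, kc i * α i v))) ≤ C₂ * Real.exp (-k * z) := by
  have hcard : Fintype.card (Fin n) = Module.finrank ℝ (EuclideanSpace ℝ (Fin n)) := by simp
  have : Nonempty (Fin n) := ⟨⟨0, hn⟩⟩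
  have hω : ∀ i, 0 < ‖ω i‖ := fun i => norm_pos_iff.2 fun h => by simpa [h] using hdual i i
  obtain ⟨⟨i, rfl⟩, hmin⟩ := hk
  have hle : ∀ j, kc i / ‖ω i‖ * ‖ω j‖ ≤ kc j := fun j =>
    (le_div_iff₀ (hω j)).1 (hmin ⟨j, rfl⟩)
  obtain ⟨C₁, hC₁, h₁⟩ := exists_le_setIntegral_cone volume hcard hdual hkc i
  obtain ⟨C₂, hC₂, h₂⟩ := exists_setIntegral_cone_le volume hcard hdual hkc (div_pos (hkc i) (hω i)) hle
  exact ⟨C₁, hC₁, C₂, hC₂, fun z hz => ⟨h₁ z hz, h₂ z hz⟩⟩
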